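/- Let (X,Y) be jointly distributed random variables on finite alphabets, fix a pair of values (x,y) with P_x > 0 and P_y > 0, let N ≥ 3 be an integer, δ > 0, and let C ≥ 90000 be a constant. If f(Δ_{xy}, P_x·P_y) ≥ C·(log N / N)·log(2/δ), then with probability greater than 1−3δ over N i.i.d. samples of (X,Y), the empirical quantities satisfy P̂_x·P̂_y > 0 and f(Δ̂_{xy}, P̂_x·P̂_y) > (1/50)·f(Δ_{xy}, P_x·P_y), where Δ̂_{xy} = P̂_{xy} − P̂_x·P̂_y. -/

import Mathlib

open scoped BigOperators

noncomputable section

open Classical in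
/-- Probability that `N` i.i.d. samples from the pmf `p` satisfy the event `E`. -/
noncomputable def iidProb {α : Type*} [Fintype α] (p : α → ℝ) (N : ℕ)
    (E : (Fin N → α) → Prop) : ℝ :=
  ∑ s : Fin N → α, if E s then ∏ i, p (s i) else 0

open Classical in
/-- Empirical frequency (relative frequency) of the outcome `a` among the samples `s`. -/
noncomputable def empFreq {α : Type*} [Fintype α] {N : ℕ} (s : Fin N → α) (a : α) : ℝ :=
  ((Finset.univ.filter fun i => s i = a).card : ℝ) / N

/-- Marginal of the first coordinate of a joint pmf. -/
noncomputable def margFst {α β : Type*} [Fintype β] (p : α × β → ℝ) (x : α) : ℝ :=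
  ∑ y, p (x, y)

/-- Marginal of the second coordinate of a joint pmf. -/
noncomputable def margSnd {α β : Type*} [Fintype α] (p : α × β → ℝ) (y : β) : ℝ :=
  ∑ x, p (x, y)

/-- Mutual information `I(X;Y)` of a joint pmf on `α × β` (natural logarithm;
summands with zero probability vanish since `Real.log 0 = 0` and `x / 0 = 0`). -/
noncomputable def mutInfo {α β : Type*} [Fintype α] [Fintype β] (p : α × β → ℝ) : ℝ :=
  ∑ x, ∑ y, p (x, y) * Real.log (p (x, y) / (margFst p x * margSnd p y))

/-- Conditional mutual information `I(X;Y∣Z)` of a joint pmf on `α × β × γ`. -/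
noncomputable def condMutInfo {α β γ : Type*} [Fintype α] [Fintype β] [Fintype γ]
    (p : α × β × γ → ℝ) : ℝ :=
  ∑ x, ∑ y, ∑ z, p (x, y, z) *
    Real.log (p (x, y, z) * (∑ x', ∑ y', p (x', y', z)) /
      ((∑ y', p (x, y', z)) * (∑ x', p (x', y, z))))

/-- `f(a,b) = (a+b)·log((a+b)/b) − a`, the pointwise contribution of a cell to a
KL divergence (natural log; the convention `0 · log 0 = 0` holds since `Real.log 0 = 0`). -/
noncomputable def fKL (a b : ℝ) : ℝ := (a + b) * Real.log ((a + b) / b) - a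
section Probability

variable {α : Type*} [Fintype α]

lemma iidProb_nonneg {p : α → ℝ} (hp : ∀ a, 0 ≤ p a) (N : ℕ) (E : (Fin N → α) → Prop) :
    0 ≤ iidProb p N E := by
  unfold iidProb
  refine Finset.sum_nonneg fun s _ => ?_
  split_ifs
  · exact Finset.prod_nonneg fun i _ => hp _
  · exact le_rfl

/-- Union bound for the complement of three exceptional events. -/
lemma one_sub_le_iidProb_of_three {p : α → ℝ} (hp : ∀ a, 0 ≤ p a) (hsum : ∑ a, p a = 1) {N : ℕ}
    {E B₁ B₂ B₃ : (Fin N → α) → Prop} (h : ∀ s, ¬ B₁ s → ¬ B₂ s → ¬ B₃ s → E s) :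
    1 - (iidProb p N B₁ + iidProb p N B₂ + iidProb p N B₃) ≤ iidProb p N E := by
  have h1 : (1 : ℝ) = ∑ s : Fin N → α, ∏ i, p (s i) := by
    rw [← Fintype.sum_pow, hsum, one_pow]
  rw [h1]
  unfold iidProb
  rw [← Finset.sum_add_distrib, ← Finset.sum_add_distrib, ← Finset.sum_sub_distrib]
  refine Finset.sum_le_sum fun s _ => ?_
  have hw : 0 ≤ ∏ i, p (s i) := Finset.prod_nonneg fun i _ => hp _
  have hs := h s
  by_cases hE : E s
  · simp only [hE, if_true]
    split_ifs <;> linarith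
  · simp only [hE, if_false]
    split_ifs <;> first | linarith | tauto

lemma sum_mul_empFreq {N : ℕ} (s : Fin N → α) (g : α → ℝ) :
    ∑ a, g a * empFreq s a = (∑ i, g (s i)) / N := by
  classical
  have h : ∑ i, g (s i) = ∑ a, g a * ((Finset.univ.filter fun i => s i = a).card : ℝ) := by
    rw [← Finset.sum_fiberwise (s := Finset.univ) (g := s)]
    refine Finset.sum_congr rfl fun a _ => ?_
    rw [Finset.sum_congr rfl (g := fun _ => g a)]
    · rw [Finset.sum_const, nsmul_eq_mul, mul_comm]
    · intro i hi
      rw [(Finset.mem_filter.mp hi).2]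
  rw [h, Finset.sum_div]
  refine Finset.sum_congr rfl fun a _ => ?_
  unfold empFreq
  rw [mul_div_assoc]

/-- Exponential Markov inequality for sums of i.i.d. variables. -/
lemma iidProb_le_exp_mul {p : α → ℝ} (hp : ∀ a, 0 ≤ p a) (N : ℕ) (h : α → ℝ) (T : ℝ) :
    iidProb p N (fun s => T ≤ ∑ i, h (s i)) ≤
      Real.exp (-T) * (∑ a, p a * Real.exp (h a)) ^ N := by
  rw [Fintype.sum_pow, Finset.mul_sum]
  unfold iidProb
  refine Finset.sum_le_sum fun s _ => ?_
  have hw : 0 ≤ ∏ i, p (s i) := Finset.prod_nonneg fun i _ => hp _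
  rw [Finset.prod_mul_distrib, ← Real.exp_sum, mul_left_comm, ← Real.exp_add]
  split_ifs with hT
  · exact le_mul_of_one_le_right hw (Real.one_le_exp (by linarith))
  · positivity

/-- Chernoff bound for the empirical frequency of a set with indicator `g`, in the direction `σ`. -/
lemma iidProb_deviation_le {p : α → ℝ} (hp : ∀ a, 0 ≤ p a) (hsum : ∑ a, p a = 1) {N : ℕ}
    (hN : 0 < N) {g : α → ℝ} (hg : ∀ a, g a = 0 ∨ g a = 1) {σ : ℝ} (hσ : σ = 1 ∨ σ = -1)
    {η M : ℝ} (hη : 0 < η) (hη1 : η ≤ 1) (hM : ∑ a, g a * p a ≤ M) :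
    iidProb p N (fun s => η * M ≤ σ * (∑ a, g a * empFreq s a - ∑ a, g a * p a)) ≤
      Real.exp (-(N * M * η ^ 2 / 4)) := by
  have hN' : (0 : ℝ) < N := by exact_mod_cast hN
  set m := ∑ a, g a * p a with hm
  have hσ2 : σ ^ 2 = 1 := by rcases hσ with rfl | rfl <;> norm_num
  set θ := σ * η / 2 with hθ
  have hθ2 : θ ^ 2 = η ^ 2 / 4 := by rw [hθ, div_pow, mul_pow, hσ2]; ring
  have hθ1 : |θ| ≤ 1 := by
    rw [abs_le]; rcases hσ with h | h <;> rw [hθ, h] <;> constructor <;> linarith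
  have hexp : Real.exp θ ≤ 1 + θ + θ ^ 2 := by
    have := (abs_le.mp (Real.abs_exp_sub_one_sub_id_le hθ1)).2
    linarith
  have hm0 : 0 ≤ m := Finset.sum_nonneg fun a _ => by
    rcases hg a with h | h <;> rw [h] <;> simp [hp a]
  have hmgf : ∑ a, p a * Real.exp (θ * g a) ≤ Real.exp (m * (θ + θ ^ 2)) := by
    calc ∑ a, p a * Real.exp (θ * g a)
        ≤ ∑ a, (p a + g a * p a * (θ + θ ^ 2)) := by
          refine Finset.sum_le_sum fun a _ => ?_
          rcases hg a with h | h <;> rw [h]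
          · simp
          · have := mul_le_mul_of_nonneg_left hexp (hp a)
            rw [mul_one]
            linarith
      _ = m * (θ + θ ^ 2) + 1 := by
          rw [Finset.sum_add_distrib, hsum, ← Finset.sum_mul, add_comm]
      _ ≤ _ := Real.add_one_le_exp _
  have hmgf0 : 0 ≤ ∑ a, p a * Real.exp (θ * g a) :=
    Finset.sum_nonneg fun a _ => mul_nonneg (hp a) (Real.exp_pos _).le
  have hev : (fun s : Fin N → α => η * M ≤ σ * (∑ a, g a * empFreq s a - m)) =
      fun s => N * (θ * m + η ^ 2 * M / 2) ≤ ∑ i, θ * g (s i) := by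
    funext s
    rw [sum_mul_empFreq, ← Finset.mul_sum]
    set S := ∑ i, g (s i)
    have key : θ * S - N * (θ * m + η ^ 2 * M / 2) =
        (N * η / 2) * (σ * (S / N - m) - η * M) := by
      rw [hθ]; field_simp; ring
    have hpos : 0 < N * η / 2 := by positivity
    apply propext
    rw [← sub_nonneg, ← sub_nonneg (b := N * (θ * m + η ^ 2 * M / 2)), key]
    exact (mul_nonneg_iff_of_pos_left hpos).symm
  rw [hev]
  refine (iidProb_le_exp_mul hp N (fun a => θ * g a) _).trans ?_
  calc _ ≤ Real.exp (-(N * (θ * m + η ^ 2 * M / 2))) * Real.exp (m * (θ + θ ^ 2)) ^ N := by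
        gcongr
    _ = Real.exp (-(N * (θ * m + η ^ 2 * M / 2)) + N * (m * (θ + θ ^ 2))) := by
        rw [Real.exp_add, Real.exp_nat_mul]
    _ ≤ _ := by
        rw [Real.exp_le_exp, hθ2]
        have := mul_le_mul_of_nonneg_left hM (by positivity : 0 ≤ N * η ^ 2 / 4)
        linarith

end Probability

section Divergence

lemma fKL_sub_self (q b : ℝ) : fKL (q - b) b = q * Real.log (q / b) - q + b := by
  simp only [fKL, sub_add_cancel]; ring

lemma sub_one_add_exp_neg_le {s : ℝ} (hs : 0 ≤ s) : s - 1 + Real.exp (-s) ≤ s ^ 2 / (1 + s) := by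
  have h : Real.exp (-s) ≤ (1 + s)⁻¹ := by
    rw [Real.exp_neg]
    exact inv_anti₀ (by linarith) (by linarith [Real.add_one_le_exp s])
  have h2 : s ^ 2 / (1 + s) = s - 1 + (1 + s)⁻¹ := by
    field_simp; ring
  linarith

lemma le_sub_one_add_exp_neg {s : ℝ} (hs : 0 ≤ s) : s ^ 2 / (2 + s) ≤ s - 1 + Real.exp (-s) := by
  have h1 : 1 ≤ Real.exp s := Real.one_le_exp hs
  have h := Real.le_log_one_add_of_nonneg (x := Real.exp s - 1) (by linarith)
  rw [add_sub_cancel, Real.log_exp, div_le_iff₀ (by linarith)] at h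
  have h2 : s ^ 2 / (2 + s) = s - 1 + (2 - s) / (2 + s) := by
    field_simp; ring
  rw [h2]
  have h3 : (2 - s) / (2 + s) ≤ Real.exp (-s) := by
    rw [Real.exp_neg, div_le_iff₀ (by linarith), ← div_eq_inv_mul, le_div_iff₀ (by linarith)]
    nlinarith
  linarith

lemma fKL_eq_mul {q b : ℝ} (hq : 0 < q) (hb : 0 < b) :
    fKL (q - b) b =
      q * (Real.log (q / b) - 1 + Real.exp (-Real.log (q / b))) := by
  rw [fKL_sub_self, Real.exp_neg, Real.exp_log (by positivity)]
  field_simp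

lemma fKL_le_sq_div {q b : ℝ} (hq : 0 ≤ q) (hb : 0 < b) : fKL (q - b) b ≤ (b - q) ^ 2 / b := by
  rw [fKL_sub_self]
  have h : q * Real.log (q / b) ≤ q * (q / b - 1) := by
    rcases hq.eq_or_lt with rfl | hq
    · simp
    · exact mul_le_mul_of_nonneg_left (Real.log_le_sub_one_of_pos (by positivity)) hq.le
  have h2 : (b - q) ^ 2 / b = q * (q / b - 1) - q + b := by field_simp; ring
  linarith

lemma sq_div_le_fKL {q b : ℝ} (hq : 0 ≤ q) (hqb : q ≤ b) (hb : 0 < b) :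
    (b - q) ^ 2 / (2 * b) ≤ fKL (q - b) b := by
  rw [fKL_sub_self]
  rcases hq.eq_or_lt with rfl | hq
  · have : (b - 0) ^ 2 / (2 * b) = b / 2 := by field_simp; ring
    rw [this]; simp; linarith
  have hl : 0 ≤ Real.log (b / q) := Real.log_nonneg ((one_le_div hq).mpr hqb)
  have h := Real.self_le_sinh_iff.mpr hl
  rw [Real.sinh_eq, Real.exp_neg, Real.exp_log (by positivity), inv_div] at h
  have h3 : Real.log (q / b) = - Real.log (b / q) := by rw [← Real.log_inv, inv_div]
  have h4 := mul_le_mul_of_nonneg_left h hq.le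
  have h2 : (b - q) ^ 2 / (2 * b) = -(q * ((b / q - q / b) / 2)) - q + b := by
    field_simp; ring
  rw [h3, h2]; linarith

/-- Stability of `fKL` in the regime of positive dependence. -/
lemma fKL_div_lt_of_pos {q b q' b' η : ℝ} (hb : 0 < b) (hqb : b < q) (hη : 0 < η)
    (hη1 : η ≤ 1 / 150) (h : 22500 * η ^ 2 * q ≤ fKL (q - b) b) (hq' : (1 - η) * q ≤ q')
    (hb0 : 0 < b') (hb' : b' ≤ (1 + η) ^ 2 * b) :
    1 / 50 * fKL (q - b) b < fKL (q' - b') b' := by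
  have hq : 0 < q := hb.trans hqb
  have h1η : 0 < 1 - η := by linarith
  have hq0 : 0 < q' := lt_of_lt_of_le (by positivity) hq'
  have hpos : 0 < fKL (q - b) b := lt_of_lt_of_le (by positivity) h
  rw [fKL_eq_mul hq0 hb0]
  rw [fKL_eq_mul hq hb] at h hpos ⊢
  set s := Real.log (q / b) with hs
  set s' := Real.log (q' / b') with hs'
  have hs0 : 0 ≤ s := Real.log_nonneg ((one_le_div hb).mpr hqb.le)
  have hup := sub_one_add_exp_neg_le hs0
  set k := s - 1 + Real.exp (-s)
  have hk0 : 0 < k := by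
    by_contra hk
    exact absurd hpos (not_lt.mpr (mul_nonpos_of_nonneg_of_nonpos hq.le (not_lt.mp hk)))
  have hkη : 22500 * η ^ 2 ≤ k := by
    by_contra hk
    have := mul_lt_mul_of_pos_left (not_le.mp hk) hq
    linarith
  have hks : k ≤ s ^ 2 := hup.trans (div_le_self (sq_nonneg s) (by linarith))
  have hsη : 150 * η ≤ s := abs_le_of_sq_le_sq' (by nlinarith) hs0 |>.2
  have hlog : s - 4 * η ≤ s' := by
    have h1 : Real.log ((1 - η) * q / ((1 + η) ^ 2 * b)) ≤ s' :=
      Real.log_le_log (by positivity) (div_le_div₀ hq0.le hq' hb0 hb')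
    have h2 : Real.log ((1 - η) * q / ((1 + η) ^ 2 * b)) =
        s + Real.log (1 - η) - 2 * Real.log (1 + η) := by
      rw [hs, Real.log_div (by positivity) (by positivity), Real.log_mul (by positivity)
        (by positivity), Real.log_mul (by positivity) (by positivity), Real.log_pow,
        Real.log_div (by positivity) (by positivity)]
      push_cast; ring
    have h3 := Real.log_le_sub_one_of_pos (by linarith : 0 < 1 + η)
    have h4 := Real.one_sub_inv_le_log_of_pos h1η
    have h5 : (1 - η)⁻¹ ≤ 1 + 2 * η := by
      rw [inv_le_iff_one_le_mul₀ h1η]; nlinarith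
    linarith
  have hss : s / 2 ≤ s' := by linarith
  have hlow := le_sub_one_add_exp_neg (s := s') (by linarith)
  have hmono : k / 8 ≤ s' ^ 2 / (2 + s') := by
    have h1 : k / 8 ≤ s ^ 2 / (1 + s) / 8 := by linarith
    refine h1.trans ?_
    rw [div_div, div_le_div_iff₀ (by positivity) (by linarith)]
    have e1 : s ^ 2 * 2 ≤ s' ^ 2 * 8 := by nlinarith
    have e2 : s ^ 2 * s' ≤ s' ^ 2 * (s * 8) := by
      have : s * s ≤ s' * (s * 8) := by nlinarith
      nlinarith [mul_le_mul_of_nonneg_right this (by linarith : 0 ≤ s')]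
    nlinarith
  have hk8 : k / 8 ≤ s' - 1 + Real.exp (-s') := hmono.trans hlow
  have hq9 : q / 2 ≤ q' := by nlinarith
  calc 1 / 50 * (q * k) < q / 2 * (k / 8) := by nlinarith [mul_pos hq hk0]
    _ ≤ _ := mul_le_mul hq9 hk8 (by positivity) hq0.le

/-- Stability of `fKL` in the regime of negative dependence. -/
lemma fKL_div_lt_of_neg {q b q' b' η : ℝ} (hq : 0 ≤ q) (hb : 0 < b) (hqb : q < b) (hη : 0 < η)
    (h : 22500 * η ^ 2 * b ≤ fKL (q - b) b) (hq0 : 0 ≤ q')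
    (hq' : q' ≤ q + η * b) (hb' : (1 - η) ^ 2 * b ≤ b') :
    1 / 50 * fKL (q - b) b < fKL (q' - b') b' := by
  have hup := fKL_le_sq_div hq hb
  have hpos : 0 < fKL (q - b) b := lt_of_lt_of_le (by positivity) h
  have hgap : 150 * (η * b) ≤ b - q := by
    have h1 := (le_div_iff₀ hb).mp (h.trans hup)
    exact abs_le_of_sq_le_sq' (by nlinarith) (by linarith) |>.2
  have hηb : 0 < η * b := by positivity
  have hb1 : b - 2 * (η * b) ≤ b' := by nlinarith [mul_pos hη hηb]
  have hd : (b - q) / 2 ≤ b' - q' := by linarith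
  have hq'b : q' < b := by linarith
  have hb0 : 0 < b' := by linarith
  have hlow := sq_div_le_fKL hq0 (by linarith : q' ≤ b') hb0
  refine lt_of_lt_of_le ?_ hlow
  have hstep : (b - q) ^ 2 / b / 40 ≤ (b' - q') ^ 2 / (2 * b') := by
    rw [div_div, div_le_div_iff₀ (by positivity) (by positivity)]
    have hbq : 0 < b - q := by linarith
    have hd0 : 0 ≤ b' - q' := by linarith
    have e1 : b' * (b - q) ≤ 4 * (b * (b' - q')) := by
      nlinarith [mul_nonneg hq0 hbq.le, mul_nonneg hq hd0, mul_le_mul_of_nonneg_left hd hb.le,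
        mul_nonneg hd0 hbq.le]
    have e2 : b' * (b - q) * (b - q) ≤ 4 * (b * (b' - q')) * (2 * (b' - q')) :=
      mul_le_mul e1 (by linarith) hbq.le (by positivity)
    nlinarith [mul_nonneg hb.le (sq_nonneg (b' - q'))]
  linarith

/-- A large divergence forces a joint probability of order `t` when `b ≥ q²`. -/
lemma le_of_log_mul_le_fKL {q b t : ℝ} {N : ℕ} (hN : 3 ≤ N) (hb : 0 < b) (hqb : b < q)
    (hbq : q ^ 2 ≤ b) (ht : 1 ≤ N * t) (h : 90000 * Real.log N * t ≤ fKL (q - b) b) :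
    90000 * t ≤ q := by
  have hq : 0 < q := hb.trans hqb
  have hN3 : (3 : ℝ) ≤ N := by exact_mod_cast hN
  have hN0 : (0 : ℝ) < N := by linarith
  have hlogN : 1 ≤ Real.log N := by
    rw [Real.le_log_iff_exp_le hN0]
    linarith [Real.exp_one_lt_d9]
  have hs : Real.log (q / b) ≤ Real.log q⁻¹ := by
    refine Real.log_le_log (by positivity) ?_
    rw [div_le_iff₀ hb, ← div_eq_inv_mul, le_div_iff₀ hq]
    linarith [sq q]
  rw [fKL_sub_self] at h
  have hDs : 90000 * Real.log N * t ≤ q * Real.log q⁻¹ := by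
    have := mul_le_mul_of_nonneg_left hs hq.le
    linarith
  have hqN : 1 ≤ N * q := by
    by_contra hlt
    push Not at hlt
    have hw : 0 < N * q := by positivity
    have e1 : Real.log q⁻¹ = Real.log N + Real.log (N * q)⁻¹ := by
      rw [← Real.log_mul (by positivity) (by positivity)]
      congr 1; field_simp
    have e2 := Real.log_le_sub_one_of_pos (inv_pos.mpr hw)
    have e3 : N * q * Real.log (N * q)⁻¹ ≤ 1 - N * q := by
      have := mul_le_mul_of_nonneg_left e2 hw.le
      rwa [mul_sub, mul_inv_cancel₀ hw.ne', mul_one] at this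
    have e4 : N * (q * Real.log q⁻¹) ≤ Real.log N := by
      rw [e1]; nlinarith
    have e5 := mul_le_mul_of_nonneg_left hDs hN0.le
    nlinarith
  have hlq : Real.log q⁻¹ ≤ Real.log N := by
    refine Real.log_le_log (by positivity) ?_
    rw [inv_le_iff_one_le_mul₀ hq]; exact hqN
  by_contra hlt
  push Not at hlt
  have e1 := mul_le_mul_of_nonneg_left hlq hq.le
  have e2 := mul_lt_mul_of_pos_right hlt (by linarith : 0 < Real.log N)
  linarith

end Divergence

section Marginals

lemma le_margFst {A B : Type*} [Fintype B] {p : A × B → ℝ} (hp : ∀ w, 0 ≤ p w) (x : A) (y : B) :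
    p (x, y) ≤ margFst p x :=
  Finset.single_le_sum (f := fun y => p (x, y)) (fun _ _ => hp _) (Finset.mem_univ y)

lemma le_margSnd {A B : Type*} [Fintype A] {p : A × B → ℝ} (hp : ∀ w, 0 ≤ p w) (x : A) (y : B) :
    p (x, y) ≤ margSnd p y :=
  Finset.single_le_sum (f := fun x => p (x, y)) (fun _ _ => hp _) (Finset.mem_univ x)

variable {A B : Type*} [Fintype A] [Fintype B]

open Classical in
lemma margFst_eq_sum (p : A × B → ℝ) (x : A) :
    margFst p x = ∑ w, (if w.1 = x then 1 else 0) * p w := by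
  simp [margFst, Fintype.sum_prod_type_right]

open Classical in
lemma margSnd_eq_sum (p : A × B → ℝ) (y : B) :
    margSnd p y = ∑ w, (if w.2 = y then 1 else 0) * p w := by
  simp [margSnd, Fintype.sum_prod_type]

lemma margFst_le_one {p : A × B → ℝ} (hp : ∀ w, 0 ≤ p w) (hsum : ∑ w, p w = 1) (x : A) :
    margFst p x ≤ 1 := by
  rw [← hsum, Fintype.sum_prod_type]
  exact Finset.single_le_sum (f := fun x => ∑ y, p (x, y))
    (fun _ _ => Finset.sum_nonneg fun _ _ => hp _) (Finset.mem_univ x)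

lemma margSnd_le_one {p : A × B → ℝ} (hp : ∀ w, 0 ≤ p w) (hsum : ∑ w, p w = 1) (y : B) :
    margSnd p y ≤ 1 := by
  rw [← hsum, Fintype.sum_prod_type_right]
  exact Finset.single_le_sum (f := fun y => ∑ x, p (x, y))
    (fun _ _ => Finset.sum_nonneg fun _ _ => hp _) (Finset.mem_univ y)

lemma empFreq_nonneg {α : Type*} [Fintype α] {N : ℕ} (s : Fin N → α) (a : α) :
    0 ≤ empFreq s a := by
  unfold empFreq; positivity

/-- Simultaneous Chernoff bounds for a joint cell and its two marginals. -/
lemma one_sub_lt_iidProb_of_deviation {p : A × B → ℝ} (hp : ∀ w, 0 ≤ p w) (hsum : ∑ w, p w = 1)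
    (x : A) (y : B) {N : ℕ} (hN : 0 < N) {δ : ℝ} (hδ : 0 < δ) {σ : ℝ} (hσ : σ = 1 ∨ σ = -1)
    {η M : ℝ} (hη : 0 < η) (hη1 : η ≤ 1) (hM : p (x, y) ≤ M) (hMx : M ≤ margFst p x)
    (hMy : M ≤ margSnd p y) (hL : N * M * η ^ 2 / 4 = Real.log (2 / δ))
    {E : (Fin N → A × B) → Prop}
    (hE : ∀ s, σ * (empFreq s (x, y) - p (x, y)) < η * M →
      -σ * (margFst (empFreq s) x - margFst p x) < η * margFst p x →
      -σ * (margSnd (empFreq s) y - margSnd p y) < η * margSnd p y → E s) :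
    1 - 3 * δ < iidProb p N E := by
  classical
  have hσ' : -σ = 1 ∨ -σ = -1 := by rcases hσ with rfl | rfl <;> simp
  have hjoint : ∀ r : A × B → ℝ, ∑ w, (if w = (x, y) then 1 else 0) * r w = r (x, y) := by
    intro r; simp
  have hexp : ∀ M', M ≤ M' → Real.exp (-(N * M' * η ^ 2 / 4)) ≤ δ / 2 := by
    intro M' h
    have h1 : Real.exp (-(N * M * η ^ 2 / 4)) = δ / 2 := by
      rw [hL, Real.exp_neg, Real.exp_log (by positivity), inv_div]
    rw [← h1]
    gcongr
  have b1 := (iidProb_deviation_le hp hsum hN (g := fun w => if w = (x, y) then 1 else 0)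
    (fun w => by by_cases h : w = (x, y) <;> simp [h]) hσ hη hη1
    ((hjoint p).trans_le hM)).trans (hexp M le_rfl)
  have b2 := (iidProb_deviation_le hp hsum hN (g := fun w => if w.1 = x then 1 else 0)
    (fun w => by by_cases h : w.1 = x <;> simp [h]) hσ' hη hη1
    (margFst_eq_sum p x).ge).trans (hexp _ hMx)
  have b3 := (iidProb_deviation_le hp hsum hN (g := fun w => if w.2 = y then 1 else 0)
    (fun w => by by_cases h : w.2 = y <;> simp [h]) hσ' hη hη1
    (margSnd_eq_sum p y).ge).trans (hexp _ hMy)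
  simp only [hjoint] at b1
  simp only [← margFst_eq_sum] at b2
  simp only [← margSnd_eq_sum] at b3
  have := one_sub_le_iidProb_of_three hp hsum
    (fun s h1 h2 h3 => hE s (not_le.mp h1) (not_le.mp h2) (not_le.mp h3))
  linarith

end Marginals

/-- If `f(Δ_{xy}, P_x·P_y)` is large then, with probability more than `1 − 3δ`, the empirical
quantities satisfy `P̂_x·P̂_y > 0` and `f(Δ̂_{xy}, P̂_x·P̂_y) > (1/50)·f(Δ_{xy}, P_x·P_y)`. -/
theorem f_large_preserved {A B : Type*} [Fintype A] [Fintype B]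
    (p : A × B → ℝ) (hp : ∀ w, 0 ≤ p w) (hsum : (∑ w, p w) = 1)
    (x : A) (y : B) (hx : 0 < margFst p x) (hy : 0 < margSnd p y)
    (N : ℕ) (hN : 3 ≤ N) (δ : ℝ) (hδ : 0 < δ) (C : ℝ) (hC : 90000 ≤ C)
    (hf : C * (Real.log N / N) * Real.log (2 / δ) ≤
        fKL (p (x, y) - margFst p x * margSnd p y) (margFst p x * margSnd p y)) :
    1 - 3 * δ < iidProb p N (fun s =>
      0 < margFst (empFreq s) x * margSnd (empFreq s) y ∧
      (1 / 50) * fKL (p (x, y) - margFst p x * margSnd p y)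
          (margFst p x * margSnd p y) <
        fKL (empFreq s (x, y) - margFst (empFreq s) x * margSnd (empFreq s) y)
          (margFst (empFreq s) x * margSnd (empFreq s) y)) := by
  have hNpos : 0 < N := by omega
  have hN3 : (3 : ℝ) ≤ N := by exact_mod_cast hN
  have hN0 : (0 : ℝ) < N := by linarith
  rcases lt_or_ge (1 / 3) δ with hδ3 | hδ3
  · exact lt_of_lt_of_le (by linarith) (iidProb_nonneg hp N _)
  have hL : 1 ≤ Real.log (2 / δ) := by
    rw [Real.le_log_iff_exp_le (by positivity), le_div_iff₀ hδ]
    nlinarith [Real.exp_one_lt_d9, Real.exp_pos 1]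
  have hlogN : 1 ≤ Real.log N := by
    rw [Real.le_log_iff_exp_le hN0]
    linarith [Real.exp_one_lt_d9]
  set q := p (x, y) with hq_def
  set px := margFst p x with hpx
  set py := margSnd p y with hpy
  set t := Real.log (2 / δ) / N with ht_def
  have ht : 0 < t := by positivity
  have hNt : N * t = Real.log (2 / δ) := by rw [ht_def]; field_simp
  have hf1 : 90000 * Real.log N * t ≤ fKL (q - px * py) (px * py) := by
    refine le_trans ?_ hf
    have e : C * (Real.log N / N) * Real.log (2 / δ) = C * (Real.log N * t) := by
      rw [ht_def]; ring
    rw [e, mul_assoc]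
    exact mul_le_mul_of_nonneg_right hC (by positivity)
  have hf2 : 90000 * t ≤ fKL (q - px * py) (px * py) := by nlinarith
  clear hf
  have hb : 0 < px * py := mul_pos hx hy
  have hq : 0 ≤ q := hp _
  have hqx : q ≤ px := le_margFst hp x y
  have hqy : q ≤ py := le_margSnd hp x y
  have hpx1 : px ≤ 1 := margFst_le_one hp hsum x
  have hpy1 : py ≤ 1 := margSnd_le_one hp hsum y
  have hη : ∀ M, 90000 * t ≤ M → 0 < √(4 * t / M) ∧ √(4 * t / M) ≤ 1 / 150 ∧
      √(4 * t / M) ^ 2 * M = 4 * t := by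
    intro M hM
    have hM0 : 0 < M := by linarith
    refine ⟨by positivity, ?_, ?_⟩
    · rw [Real.sqrt_le_left (by norm_num), div_le_iff₀ hM0]
      linarith
    · rw [Real.sq_sqrt (by positivity)]
      field_simp
  rcases lt_trichotomy q (px * py) with hlt | heq | hgt
  · have hM : 90000 * t ≤ px * py := by
      refine hf2.trans ((fKL_le_sq_div hq hb).trans ?_)
      rw [div_le_iff₀ hb]
      nlinarith
    obtain ⟨h0, h1, h2⟩ := hη _ hM
    set η := √(4 * t / (px * py))
    refine one_sub_lt_iidProb_of_deviation hp hsum x y hNpos hδ (Or.inl rfl) h0 (by linarith)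
      hlt.le (mul_le_of_le_one_right hx.le hpy1) (mul_le_of_le_one_left hy.le hpx1)
      (by rw [← hNt]; linear_combination (N / 4 : ℝ) * h2) fun s hs1 hs2 hs3 => ?_
    have hx' : (1 - η) * px < margFst (empFreq s) x := by linarith
    have hy' : (1 - η) * py < margSnd (empFreq s) y := by linarith
    have hη0 : 0 < 1 - η := by linarith
    have hx0 : 0 < (1 - η) * px := by positivity
    have hy0 : 0 < (1 - η) * py := by positivity
    refine ⟨mul_pos (hx0.trans hx') (hy0.trans hy'), ?_⟩
    refine fKL_div_lt_of_neg hq hb hlt h0 (by linarith) (empFreq_nonneg s _) (by linarith) ?_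
    calc (1 - η) ^ 2 * (px * py) = (1 - η) * px * ((1 - η) * py) := by ring
      _ ≤ _ := mul_le_mul hx'.le hy'.le hy0.le (hx0.trans hx').le
  · rw [heq, fKL_sub_self, div_self hb.ne', Real.log_one] at hf2
    linarith
  · have hM : 90000 * t ≤ q :=
      le_of_log_mul_le_fKL hN hb hgt (by rw [sq]; exact mul_le_mul hqx hqy hq hx.le)
        (hNt ▸ hL) hf1
    obtain ⟨h0, h1, h2⟩ := hη _ hM
    set η := √(4 * t / q)
    refine one_sub_lt_iidProb_of_deviation hp hsum x y hNpos hδ (Or.inr rfl) h0 (by linarith)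
      le_rfl hqx hqy
      (by rw [← hNt]; linear_combination (N / 4 : ℝ) * h2) fun s hs1 hs2 hs3 => ?_
    have hx' : margFst (empFreq s) x < (1 + η) * px := by linarith
    have hy' : margSnd (empFreq s) y < (1 + η) * py := by linarith
    have hq' : (1 - η) * q < empFreq s (x, y) := by linarith
    have hη0 : 0 < 1 - η := by linarith
    have hq0 : 0 < empFreq s (x, y) := lt_trans (mul_pos hη0 (hb.trans hgt)) hq'
    have hx0 := hq0.trans_le (le_margFst (empFreq_nonneg s) x y)
    have hy0 := hq0.trans_le (le_margSnd (empFreq_nonneg s) x y)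
    refine ⟨mul_pos hx0 hy0, ?_⟩
    refine fKL_div_lt_of_pos hb hgt h0 h1 (by linarith) hq'.le (mul_pos hx0 hy0) ?_
    calc _ ≤ (1 + η) * px * ((1 + η) * py) := mul_le_mul hx'.le hy'.le hy0.le (by positivity)
      _ = _ := by ring
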